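/- Let X and Y be independent ℝ^d-valued random vectors with E[ln(1+‖X‖)] < ∞ and E[ln(1+‖Y‖)] < ∞, where Y has a probability density f with f(y) = φ(‖y‖) for some non-increasing φ and Pr(Y ≠ 0) > 0. Then for all 0 ≤ c₁ ≤ c₂ and every P > 0, E[ln(1+‖c₁X+Y‖²/P²)] ≤ E[ln(1+‖c₂X+Y‖²/P²)]; consequently the map c ↦ P₁(cX+Y) is non-decreasing in |c| for c ∈ ℝ. (This is Property (iv) of the paper's α-power, specialized to the Cauchy reference α = 1.) -/

import Mathlib

open MeasureTheory ProbabilityTheory Real Filter Topology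

/-- The standard `d`-dimensional isotropic Cauchy density. -/
noncomputable def pC (d : ℕ) (x : EuclideanSpace ℝ (Fin d)) : ℝ :=
  Real.Gamma (((d : ℝ) + 1) / 2) * Real.pi ^ (-((d : ℝ) + 1) / 2) *
    (1 + ‖x‖ ^ 2) ^ (-((d : ℝ) + 1) / 2)

/-- The logarithmic moment `c_d` of the standard isotropic Cauchy density. -/
noncomputable def cD (d : ℕ) : ℝ :=
  ∫ x : EuclideanSpace ℝ (Fin d), pC d x * Real.log (1 + ‖x‖ ^ 2)

lemma mul_add_mul_swap_le {a b c d : ENNReal} (hab : a ≤ b) (hcd : c ≤ d) :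
    a * d + b * c ≤ b * d + a * c := by
  obtain ⟨e, rfl⟩ := exists_add_of_le hab
  calc a * d + (a + e) * c = a * d + a * c + e * c := by ring
    _ ≤ a * d + a * c + e * d := by gcongr
    _ = (a + e) * d + a * c := by ring

section RadialRearrangement

variable {E : Type*} [NormedAddCommGroup E] [InnerProductSpace ℝ E]

/-- The reflection exchanging `a • x` and `b • x`, for `s = a + b`. -/
noncomputable def swapReflection (s : ℝ) (x y : E) : E :=
  (ℝ ∙ x)ᗮ.reflection y + s • x

lemma swapReflection_sub (a b : ℝ) (x y : E) :
    ‖swapReflection (a + b) x y - a • x‖ = ‖y - b • x‖ := by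
  have h : swapReflection (a + b) x y - a • x = (ℝ ∙ x)ᗮ.reflection (y - b • x) := by
    rw [swapReflection, map_sub, map_smul,
      Submodule.reflection_orthogonalComplement_singleton_eq_neg]
    module
  rw [h, LinearIsometryEquiv.norm_map]

lemma norm_sub_smul_sq (a : ℝ) (x y : E) :
    ‖y - a • x‖ ^ 2 = ‖y‖ ^ 2 - 2 * a * inner ℝ y x + a ^ 2 * ‖x‖ ^ 2 := by
  rw [norm_sub_sq_real, inner_smul_right, norm_smul, mul_pow, Real.norm_eq_abs, sq_abs]
  ring

lemma norm_swapReflection_sq (s : ℝ) (x y : E) :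
    ‖swapReflection s x y‖ ^ 2 = ‖y‖ ^ 2 - 2 * s * inner ℝ y x + s ^ 2 * ‖x‖ ^ 2 := by
  have h := swapReflection_sub 0 s x y
  simp only [zero_add, zero_smul, sub_zero] at h
  rw [h, norm_sub_smul_sq]

variable [FiniteDimensional ℝ E] [MeasurableSpace E] [BorelSpace E]

lemma swapReflection_measurePreserving (s : ℝ) (x : E) :
    MeasurePreserving (swapReflection s x) (volume : Measure E) volume :=
  (measurePreserving_add_right volume (s • x)).comp
    ((ℝ ∙ x)ᗮ.reflection.measurePreserving)

lemma lintegral_radial_translate (ψ G : ℝ → ENNReal) (a : E) :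
    ∫⁻ y : E, ψ ‖y‖ * G ‖a + y‖ = ∫⁻ y : E, ψ ‖y - a‖ * G ‖y‖ := by
  rw [← lintegral_sub_right_eq_self (fun y : E => ψ ‖y‖ * G ‖a + y‖) a]
  simp

/-- Correlating a radially non-increasing weight with a radially non-decreasing function
gives a quantity that is non-decreasing along rays from the origin. -/
lemma lintegral_radial_mono {ψ G : ℝ → ENNReal} (hψm : Measurable ψ) (hGm : Measurable G)
    (hψ : AntitoneOn ψ (Set.Ici 0)) (hG : MonotoneOn G (Set.Ici 0))
    {a b : ℝ} (ha : 0 ≤ a) (hab : a ≤ b) (x : E) :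
    ∫⁻ y : E, ψ ‖y‖ * G ‖a • x + y‖ ≤ ∫⁻ y : E, ψ ‖y‖ * G ‖b • x + y‖ := by
  rw [lintegral_radial_translate, lintegral_radial_translate]
  have hSm : Measurable (swapReflection (a + b) x) :=
    (swapReflection_measurePreserving (a + b) x).measurable
  have key : ∀ c e : ℝ, c + e = a + b →
      ∫⁻ y : E, ψ ‖y - c • x‖ * G ‖y‖ =
        ∫⁻ y : E, ψ ‖y - e • x‖ * G ‖swapReflection (a + b) x y‖ := by
    intro c e hce
    rw [← (swapReflection_measurePreserving (a + b) x).lintegral_comp (by fun_prop)]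
    simp_rw [← hce, swapReflection_sub]
  have hsum : (∫⁻ y : E, ψ ‖y - a • x‖ * G ‖y‖) + (∫⁻ y : E, ψ ‖y - a • x‖ * G ‖y‖) ≤
      (∫⁻ y : E, ψ ‖y - b • x‖ * G ‖y‖) + (∫⁻ y : E, ψ ‖y - b • x‖ * G ‖y‖) := by
    nth_rewrite 2 [key a b rfl]
    nth_rewrite 2 [key b a (add_comm b a)]
    rw [← lintegral_add_left (by fun_prop), ← lintegral_add_left (by fun_prop)]
    refine lintegral_mono fun y => ?_
    have hψ' : ∀ u v : E, ‖u‖ ^ 2 ≤ ‖v‖ ^ 2 → ψ ‖v‖ ≤ ψ ‖u‖ := fun u v h =>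
      hψ (norm_nonneg u) (norm_nonneg v) ((sq_le_sq₀ (norm_nonneg u) (norm_nonneg v)).1 h)
    have hG' : ∀ u v : E, ‖u‖ ^ 2 ≤ ‖v‖ ^ 2 → G ‖u‖ ≤ G ‖v‖ := fun u v h =>
      hG (norm_nonneg u) (norm_nonneg v) ((sq_le_sq₀ (norm_nonneg u) (norm_nonneg v)).1 h)
    rcases le_total ((a + b) * ‖x‖ ^ 2) (2 * inner ℝ y x) with h | h
    · have h1 := hψ' (y - b • x) (y - a • x) (by
        rw [norm_sub_smul_sq, norm_sub_smul_sq]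
        nlinarith [mul_nonneg (sub_nonneg.2 hab) (sub_nonneg.2 h)])
      have h2 := hG' (swapReflection (a + b) x y) y (by
        rw [norm_swapReflection_sq]
        nlinarith [mul_nonneg (by linarith : 0 ≤ a + b) (sub_nonneg.2 h)])
      exact mul_add_mul_swap_le h1 h2
    · have h1 := hψ' (y - a • x) (y - b • x) (by
        rw [norm_sub_smul_sq, norm_sub_smul_sq]
        nlinarith [mul_nonneg (sub_nonneg.2 hab) (sub_nonneg.2 h)])
      have h2 := hG' y (swapReflection (a + b) x y) (by
        rw [norm_swapReflection_sq]
        nlinarith [mul_nonneg (by linarith : 0 ≤ a + b) (sub_nonneg.2 h)])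
      rw [add_comm, add_comm (ψ ‖y - b • x‖ * G ‖y‖)]
      exact mul_add_mul_swap_le h1 h2
  rw [← two_mul, ← two_mul] at hsum
  exact (ENNReal.mul_le_mul_iff_right (by norm_num) (by norm_num)).1 hsum

lemma lintegral_radial_neg (ψ G : ℝ → ENNReal) (x : E) :
    ∫⁻ y : E, ψ ‖y‖ * G ‖-x + y‖ = ∫⁻ y : E, ψ ‖y‖ * G ‖x + y‖ := by
  rw [← lintegral_neg_eq_self (fun y : E => ψ ‖y‖ * G ‖x + y‖)]
  simp_rw [norm_neg, ← norm_neg (x + -_), neg_add, neg_neg]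

end RadialRearrangement

lemma log_one_add_sq_div_sq_le {E : Type*} [NormedAddCommGroup E] [NormedSpace ℝ E]
    (c : ℝ) {P : ℝ} (hP : 0 < P) (x y : E) :
    Real.log (1 + ‖c • x + y‖ ^ 2 / P ^ 2) ≤
      2 * (Real.log (1 + |c| / P) + Real.log (1 + 1 / P) +
        Real.log (1 + ‖x‖) + Real.log (1 + ‖y‖)) := by
  have hx := norm_nonneg x
  have hy := norm_nonneg y
  have hc : 0 ≤ |c| / P := by positivity
  have hp : 0 ≤ 1 / P := by positivity
  rw [← Real.log_mul (by positivity) (by positivity), ← Real.log_mul (by positivity) (by positivity),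
    ← Real.log_mul (by positivity) (by positivity)]
  refine le_of_le_of_eq ?_ (mod_cast Real.log_pow _ 2)
  refine Real.log_le_log (by positivity) ?_
  have h1 : ‖c • x + y‖ / P ≤ |c| / P * ‖x‖ + 1 / P * ‖y‖ := by
    have := norm_add_le (c • x) y
    rw [norm_smul, Real.norm_eq_abs] at this
    calc ‖c • x + y‖ / P ≤ (|c| * ‖x‖ + ‖y‖) / P := by gcongr
      _ = _ := by ring
  have h2 : 0 ≤ ‖c • x + y‖ / P := by positivity
  have h3 : 1 + ‖c • x + y‖ / P ≤
      (1 + |c| / P) * (1 + 1 / P) * (1 + ‖x‖) * (1 + ‖y‖) := by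
    have h4 : 1 + |c| / P * ‖x‖ ≤ (1 + |c| / P) * (1 + ‖x‖) := by nlinarith
    have h5 : 1 + 1 / P * ‖y‖ ≤ (1 + 1 / P) * (1 + ‖y‖) := by nlinarith
    have h6 := mul_le_mul h4 h5 (by positivity) (by positivity)
    nlinarith [mul_nonneg (mul_nonneg hc hx) (mul_nonneg hp hy)]
  calc 1 + ‖c • x + y‖ ^ 2 / P ^ 2 ≤ (1 + ‖c • x + y‖ / P) ^ 2 := by
        rw [← div_pow]; nlinarith
    _ ≤ _ := pow_le_pow_left₀ (by positivity) h3 2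

lemma log_one_add_sq_div_sq_nonneg (r P : ℝ) : 0 ≤ Real.log (1 + r ^ 2 / P ^ 2) :=
  Real.log_nonneg (by linarith [show 0 ≤ r ^ 2 / P ^ 2 by positivity])

lemma integrable_log_one_add_sq_div_sq {Ω E : Type*} [MeasurableSpace Ω]
    [NormedAddCommGroup E] [NormedSpace ℝ E] [MeasurableSpace E] [BorelSpace E]
    [SecondCountableTopology E] {μ : Measure Ω} [IsFiniteMeasure μ] {X Y : Ω → E}
    (hX : Measurable X) (hY : Measurable Y)
    (hlogX : Integrable (fun ω => Real.log (1 + ‖X ω‖)) μ)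
    (hlogY : Integrable (fun ω => Real.log (1 + ‖Y ω‖)) μ) (c : ℝ) {P : ℝ} (hP : 0 < P) :
    Integrable (fun ω => Real.log (1 + ‖c • X ω + Y ω‖ ^ 2 / P ^ 2)) μ := by
  refine Integrable.mono' ((((integrable_const
    (Real.log (1 + |c| / P) + Real.log (1 + 1 / P))).add hlogX).add hlogY).const_mul 2) ?_ ?_
  · exact Measurable.aestronglyMeasurable (by fun_prop)
  · refine Eventually.of_forall fun ω => ?_
    rw [Real.norm_of_nonneg (log_one_add_sq_div_sq_nonneg _ _)]
    exact log_one_add_sq_div_sq_le c hP (X ω) (Y ω)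

/-- Property (iv) of the paper's `α`-power at `α = 1`: for independent `X, Y` with `Y`
having a rotationally symmetric norm-non-increasing density, the logarithmic cost of
`cX + Y` is non-decreasing in `|c|`, and consequently `c ↦ P₁(cX+Y)` is non-decreasing
in `|c|`. -/
theorem stmt17 (d : ℕ) (hd : 1 ≤ d)
    {Ω : Type} [MeasurableSpace Ω] (μ : Measure Ω) [IsProbabilityMeasure μ]
    (X Y : Ω → EuclideanSpace ℝ (Fin d)) (hX : Measurable X) (hY : Measurable Y)
    (hindep : IndepFun X Y μ)
    (hlogX : Integrable (fun ω => Real.log (1 + ‖X ω‖)) μ)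
    (hlogY : Integrable (fun ω => Real.log (1 + ‖Y ω‖)) μ)
    (f : EuclideanSpace ℝ (Fin d) → ℝ)
    (φ : ℝ → ℝ) (hφ : ∀ r s : ℝ, 0 ≤ r → r ≤ s → φ s ≤ φ r)
    (hfφ : ∀ x, f x = φ ‖x‖)
    (hYlaw : Measure.map Y μ = volume.withDensity (fun x => ENNReal.ofReal (f x)))
    (hYne : 0 < μ {ω | Y ω ≠ 0}) :
    (∀ c₁ c₂ : ℝ, 0 ≤ c₁ → c₁ ≤ c₂ → ∀ P : ℝ, 0 < P →
      ∫ ω, Real.log (1 + ‖c₁ • X ω + Y ω‖ ^ 2 / P ^ 2) ∂μ ≤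
        ∫ ω, Real.log (1 + ‖c₂ • X ω + Y ω‖ ^ 2 / P ^ 2) ∂μ) ∧
    ∀ c₁ c₂ P₁ P₂ : ℝ, |c₁| ≤ |c₂| → 0 < P₁ → 0 < P₂ →
      (∫ ω, Real.log (1 + ‖c₁ • X ω + Y ω‖ ^ 2 / P₁ ^ 2) ∂μ = cD d) →
      (∫ ω, Real.log (1 + ‖c₂ • X ω + Y ω‖ ^ 2 / P₂ ^ 2) ∂μ = cD d) →
      P₁ ≤ P₂ := by
  have : Nontrivial (EuclideanSpace ℝ (Fin d)) := by
    have : Nonempty (Fin d) := ⟨⟨0, hd⟩⟩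
    infer_instance
  set ψ : ℝ → ENNReal := fun r => ENNReal.ofReal (φ (max r 0)) with hψdef
  have hψa : Antitone ψ := fun r s hrs =>
    ENNReal.ofReal_le_ofReal (hφ _ _ (le_max_right _ _) (max_le_max_right 0 hrs))
  have hψm : Measurable ψ := hψa.measurable
  have hlaw : Measure.map Y μ = volume.withDensity fun y => ψ ‖y‖ := by
    simp only [hYlaw, hψdef, hfφ, max_eq_left (norm_nonneg _)]
  have hprod : Measure.map (fun ω => (X ω, Y ω)) μ = (Measure.map X μ).prod (Measure.map Y μ) :=
    (indepFun_iff_map_prod_eq_prod_map_map hX.aemeasurable hY.aemeasurable).1 hindep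
  have : IsProbabilityMeasure (Measure.map X μ) := Measure.isProbabilityMeasure_map hX.aemeasurable
  have : IsProbabilityMeasure (Measure.map Y μ) := Measure.isProbabilityMeasure_map hY.aemeasurable
  let G : ℝ → ℝ → ENNReal := fun P r => ENNReal.ofReal (Real.log (1 + r ^ 2 / P ^ 2))
  have hGm : ∀ P, Measurable (G P) := fun P => by fun_prop
  have hGmono : ∀ P, MonotoneOn (G P) (Set.Ici 0) := fun P r hr s hs hrs => by
    have hr' : 0 ≤ r := hr
    refine ENNReal.ofReal_le_ofReal (Real.log_le_log (by positivity) ?_)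
    gcongr
  have hlint : ∀ c P : ℝ, ∫⁻ ω, G P ‖c • X ω + Y ω‖ ∂μ =
      ∫⁻ x, (∫⁻ y, ψ ‖y‖ * G P ‖c • x + y‖) ∂(Measure.map X μ) := by
    intro c P
    have hm : Measurable fun p : EuclideanSpace ℝ (Fin d) × EuclideanSpace ℝ (Fin d) =>
        G P ‖c • p.1 + p.2‖ := (hGm P).comp (by fun_prop)
    calc ∫⁻ ω, G P ‖c • X ω + Y ω‖ ∂μ
        = ∫⁻ p, G P ‖c • p.1 + p.2‖ ∂(Measure.map (fun ω => (X ω, Y ω)) μ) :=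
          (lintegral_map hm (hX.prodMk hY)).symm
      _ = _ := by
          rw [hprod, lintegral_prod _ hm.aemeasurable]
          refine lintegral_congr fun x => ?_
          rw [hlaw]
          exact lintegral_withDensity_eq_lintegral_mul _ (hψm.comp measurable_norm)
            ((hGm P).comp (by fun_prop))
  have hint : ∀ c P : ℝ, 0 < P →
      Integrable (fun ω => Real.log (1 + ‖c • X ω + Y ω‖ ^ 2 / P ^ 2)) μ := fun c P hP =>
    integrable_log_one_add_sq_div_sq hX hY hlogX hlogY c hP
  have hval : ∀ c P : ℝ, 0 < P → ENNReal.ofReal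
      (∫ ω, Real.log (1 + ‖c • X ω + Y ω‖ ^ 2 / P ^ 2) ∂μ) = ∫⁻ ω, G P ‖c • X ω + Y ω‖ ∂μ :=
    fun c P hP => ofReal_integral_eq_lintegral_ofReal (hint c P hP)
      (Eventually.of_forall fun ω => log_one_add_sq_div_sq_nonneg _ _)
  have hnonneg : ∀ c P : ℝ, 0 ≤ ∫ ω, Real.log (1 + ‖c • X ω + Y ω‖ ^ 2 / P ^ 2) ∂μ :=
    fun c P => integral_nonneg fun ω => log_one_add_sq_div_sq_nonneg _ _
  have hmono : ∀ c₁ c₂ : ℝ, 0 ≤ c₁ → c₁ ≤ c₂ → ∀ P : ℝ, 0 < P →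
      ∫ ω, Real.log (1 + ‖c₁ • X ω + Y ω‖ ^ 2 / P ^ 2) ∂μ ≤
        ∫ ω, Real.log (1 + ‖c₂ • X ω + Y ω‖ ^ 2 / P ^ 2) ∂μ := by
    intro c₁ c₂ h0 h12 P hP
    rw [← ENNReal.ofReal_le_ofReal_iff (hnonneg _ _), hval _ _ hP, hval _ _ hP, hlint, hlint]
    exact lintegral_mono fun x =>
      lintegral_radial_mono hψm (hGm P) (hψa.antitoneOn _) (hGmono P) h0 h12 x
  have habs : ∀ c P : ℝ, 0 < P →
      ∫ ω, Real.log (1 + ‖|c| • X ω + Y ω‖ ^ 2 / P ^ 2) ∂μ =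
        ∫ ω, Real.log (1 + ‖c • X ω + Y ω‖ ^ 2 / P ^ 2) ∂μ := by
    intro c P hP
    rcases abs_choice c with h | h
    · rw [h]
    · rw [h, ← ENNReal.ofReal_eq_ofReal_iff (hnonneg _ _) (hnonneg _ _), hval _ _ hP, hval _ _ hP,
        hlint, hlint]
      refine lintegral_congr fun x => ?_
      rw [neg_smul]
      exact lintegral_radial_neg _ _ _
  refine ⟨hmono, fun c₁ c₂ P₁ P₂ hc hP₁ hP₂ h₁ h₂ => ?_⟩
  by_contra! hlt
  have hne : ∀ᵐ ω ∂μ, c₂ • X ω + Y ω ≠ 0 := by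
    have hac : Measure.map Y μ ≪ volume := hlaw ▸ withDensity_absolutelyContinuous _ _
    have hs : MeasurableSet {p : EuclideanSpace ℝ (Fin d) × EuclideanSpace ℝ (Fin d) |
        c₂ • p.1 + p.2 = 0} := measurableSet_eq_fun (by fun_prop) (by fun_prop)
    have h : Measure.map (fun ω => (X ω, Y ω)) μ {p | c₂ • p.1 + p.2 = 0} = 0 := by
      rw [hprod, Measure.measure_prod_null hs]
      refine Eventually.of_forall fun x => hac ?_
      refine measure_mono_null (t := {-(c₂ • x)}) (fun y hy => ?_) (measure_singleton _)
      exact eq_neg_of_add_eq_zero_right hy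
    rw [Measure.map_apply (hX.prodMk hY) hs] at h
    exact measure_eq_zero_iff_ae_notMem.1 h
  have hltlog : ∀ᵐ ω ∂μ, Real.log (1 + ‖c₂ • X ω + Y ω‖ ^ 2 / P₁ ^ 2) <
      Real.log (1 + ‖c₂ • X ω + Y ω‖ ^ 2 / P₂ ^ 2) := by
    filter_upwards [hne] with ω hω
    have := norm_pos_iff.2 hω
    refine Real.log_lt_log (by positivity) ?_
    gcongr
  have hstrict : ∫ ω, Real.log (1 + ‖c₂ • X ω + Y ω‖ ^ 2 / P₁ ^ 2) ∂μ <
      ∫ ω, Real.log (1 + ‖c₂ • X ω + Y ω‖ ^ 2 / P₂ ^ 2) ∂μ := by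
    refine lt_of_le_of_ne (integral_mono_ae (hint _ _ hP₁) (hint _ _ hP₂)
      (hltlog.mono fun _ h => h.le)) fun heq => ?_
    have h := (integral_eq_iff_of_ae_le (hint c₂ _ hP₁) (hint c₂ _ hP₂)
      (hltlog.mono fun _ h => h.le)).1 heq
    obtain ⟨ω, h1, h2⟩ := (h.and hltlog).exists
    exact h2.ne h1
  have h := hmono _ _ (abs_nonneg c₁) hc P₁ hP₁
  rw [habs _ _ hP₁, habs _ _ hP₁] at h
  linarith
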